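/- For 0 < c < 1/4 define Ω(c) = (b(c)/√2) · π/(2 K(κ(c))). Then the action integral satisfies ∫₀^{c} Ω(c′)^{-1} dc′ = (4/(3π)) · [ (1+κ(c)²) E(κ(c)) − (1−κ(c)²) K(κ(c)) ] / (1+κ(c)²)^{3/2}, and this quantity belongs to the interval [0, 2√2/(3π)). -/

import Mathlib

/-- Complete elliptic integral of the first kind,
`K(κ) = ∫₀^{π/2} (1 − κ² sin²t)^{−1/2} dt`. -/
noncomputable def ellK (κ : ℝ) : ℝ :=
  ∫ t in (0:ℝ)..(Real.pi/2), 1 / Real.sqrt (1 - κ^2 * Real.sin t ^ 2)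

/-- Complete elliptic integral of the second kind,
`E(κ) = ∫₀^{π/2} (1 − κ² sin²t)^{1/2} dt`. -/
noncomputable def ellE (κ : ℝ) : ℝ :=
  ∫ t in (0:ℝ)..(Real.pi/2), Real.sqrt (1 - κ^2 * Real.sin t ^ 2)

/-- `a(c) = (1 − √(1−4c))^{1/2}`. -/
noncomputable def aAmp (c : ℝ) : ℝ := Real.sqrt (1 - Real.sqrt (1 - 4*c))

/-- `b(c) = (1 + √(1−4c))^{1/2}`. -/
noncomputable def bAmp (c : ℝ) : ℝ := Real.sqrt (1 + Real.sqrt (1 - 4*c))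

/-- `κ(c) = a(c)/b(c)`. -/
noncomputable def kapC (c : ℝ) : ℝ := aAmp c / bAmp c

/-- The frequency `Ω(c) = (b(c)/√2) · π/(2K(κ(c)))`. -/
noncomputable def OmegaC (c : ℝ) : ℝ :=
  bAmp c / Real.sqrt 2 * Real.pi / (2 * ellK (kapC c))

open Set Filter Topology MeasureTheory

/-- Differentiation under the integral sign for integrands that are jointly continuous together
with their derivative in the parameter. -/
lemma hasDerivAt_intervalIntegral_of_continuousOn {f f' : ℝ → ℝ → ℝ} {x₀ a b : ℝ} {U : Set ℝ}
    (hU : IsOpen U) (hx₀ : x₀ ∈ U) (hf : ContinuousOn f.uncurry (U ×ˢ univ))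
    (hf' : ContinuousOn f'.uncurry (U ×ˢ univ))
    (hd : ∀ x ∈ U, ∀ t, HasDerivAt (fun y => f y t) (f' x t) x) :
    HasDerivAt (fun x => ∫ t in a..b, f x t) (∫ t in a..b, f' x₀ t) x₀ := by
  have slice {g : ℝ → ℝ → ℝ} (hg : ContinuousOn g.uncurry (U ×ˢ univ)) {x : ℝ} (hx : x ∈ U) :
      Continuous (g x) :=
    hg.comp_continuous (f := fun t => (x, t)) (by fun_prop) fun t => ⟨hx, mem_univ t⟩
  obtain ⟨ε, hε, hball⟩ := Metric.nhds_basis_closedBall.mem_iff.1 (hU.mem_nhds hx₀)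
  obtain ⟨C, hC⟩ := ((isCompact_closedBall x₀ ε).prod
    (isCompact_uIcc (a := a) (b := b))).exists_bound_of_continuousOn
    (hf'.mono (prod_mono hball (subset_univ _)))
  refine (intervalIntegral.hasDerivAt_integral_of_dominated_loc_of_deriv_le
    (bound := fun _ => C) (Metric.closedBall_mem_nhds x₀ hε) ?_
    ((slice hf hx₀).intervalIntegrable _ _) (slice hf' hx₀).aestronglyMeasurable ?_
    intervalIntegrable_const ?_).2
  · filter_upwards [hU.mem_nhds hx₀] with x hx using (slice hf hx).aestronglyMeasurable
  · exact ae_of_all _ fun t ht x hx => hC (x, t) ⟨hx, uIoc_subset_uIcc ht⟩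
  · exact ae_of_all _ fun t _ x hx => hd x (hball hx) t

/-- The complete elliptic integral of the first kind as a function of `m = κ²`. -/
noncomputable def ellKParam (m : ℝ) : ℝ :=
  ∫ t in (0:ℝ)..(Real.pi/2), 1 / Real.sqrt (1 - m * Real.sin t ^ 2)

/-- The complete elliptic integral of the second kind as a function of `m = κ²`. -/
noncomputable def ellEParam (m : ℝ) : ℝ :=
  ∫ t in (0:ℝ)..(Real.pi/2), Real.sqrt (1 - m * Real.sin t ^ 2)

lemma one_sub_mul_sin_sq_pos {m : ℝ} (hm : m < 1) (t : ℝ) : 0 < 1 - m * Real.sin t ^ 2 := by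
  rcases le_total m 0 with h | h
  · nlinarith [sq_nonneg (Real.sin t)]
  · nlinarith [Real.sin_sq_le_one t]

lemma continuous_ellEParam : Continuous ellEParam :=
  intervalIntegral.continuous_parametric_intervalIntegral_of_continuous'
    (f := fun m t => Real.sqrt (1 - m * Real.sin t ^ 2)) (by unfold Function.uncurry; fun_prop) _ _

lemma ellEParam_one : ellEParam 1 = 1 := by
  have h : ellEParam 1 = ∫ t in (0:ℝ)..(Real.pi/2), Real.cos t := by
    refine intervalIntegral.integral_congr fun t ht => ?_
    rw [uIcc_of_le (by positivity)] at ht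
    have : 1 - 1 * Real.sin t ^ 2 = Real.cos t ^ 2 := by
      linarith [Real.sin_sq_add_cos_sq t]
    simp only [this]
    exact Real.sqrt_sq (Real.cos_nonneg_of_mem_Icc ⟨by linarith [ht.1, Real.pi_pos], ht.2⟩)
  simp [h]

lemma continuous_one_div_sqrt {m : ℝ} (hm : m < 1) :
    Continuous fun t => 1 / Real.sqrt (1 - m * Real.sin t ^ 2) :=
  continuous_const.div (by fun_prop) fun t => (Real.sqrt_pos.2 (one_sub_mul_sin_sq_pos hm t)).ne'

lemma ellKParam_pos {m : ℝ} (hm : m < 1) : 0 < ellKParam m :=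
  intervalIntegral.intervalIntegral_pos_of_pos
    ((continuous_one_div_sqrt hm).intervalIntegrable _ _)
    (fun t => one_div_pos.2 (Real.sqrt_pos.2 (one_sub_mul_sin_sq_pos hm t))) (by positivity)

/-- The bracket `(1 + m) E - (1 - m) K` in the action integral. -/
noncomputable def ellBracket (m : ℝ) : ℝ := (1 + m) * ellEParam m - (1 - m) * ellKParam m

lemma ellBracket_zero : ellBracket 0 = 0 := by
  simp [ellBracket, ellEParam, ellKParam]

lemma ellBracket_eq_integral {m : ℝ} (hm : m < 1) :
    ellBracket m = ∫ t in (0:ℝ)..(Real.pi/2),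
      ((1 + m) * Real.sqrt (1 - m * Real.sin t ^ 2)
        - (1 - m) * (1 / Real.sqrt (1 - m * Real.sin t ^ 2))) := by
  rw [intervalIntegral.integral_sub, intervalIntegral.integral_const_mul,
    intervalIntegral.integral_const_mul]
  · rfl
  · exact Continuous.intervalIntegrable (by fun_prop) _ _
  · exact ((continuous_one_div_sqrt hm).const_mul _).intervalIntegrable _ _

lemma hasDerivAt_sqrt_one_sub_mul {m x : ℝ} (h : 0 < 1 - m * x) :
    HasDerivAt (fun m => Real.sqrt (1 - m * x)) (-x / (2 * Real.sqrt (1 - m * x))) m := by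
  have := ((((hasDerivAt_id m).mul_const x).const_sub 1).sqrt h.ne')
  simpa using this

lemma hasDerivAt_sin_mul_cos_div {m : ℝ} (hm : m < 1) (t : ℝ) :
    HasDerivAt (fun t => Real.sin t * Real.cos t / (2 * Real.sqrt (1 - m * Real.sin t ^ 2)))
      ((Real.cos t ^ 2 - Real.sin t ^ 2) / (2 * Real.sqrt (1 - m * Real.sin t ^ 2))
        + m * Real.sin t ^ 2 * Real.cos t ^ 2 / (2 * Real.sqrt (1 - m * Real.sin t ^ 2) ^ 3)) t := by
  have hp := one_sub_mul_sin_sq_pos hm t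
  have hu := Real.sqrt_pos.2 hp
  have h1 := ((((Real.hasDerivAt_sin t).fun_pow 2).const_mul m).const_sub 1).sqrt hp.ne'
  have h2 := ((Real.hasDerivAt_sin t).mul (Real.hasDerivAt_cos t)).div (h1.const_mul 2)
    (by positivity)
  refine h2.congr_deriv ?_
  simp only [Pi.mul_apply]
  set u := Real.sqrt (1 - m * Real.sin t ^ 2)
  field_simp
  ring

lemma hasDerivAt_ellBracket {m : ℝ} (hm : m < 1) :
    HasDerivAt ellBracket (3 / 2 * ellEParam m) m := by
  let f : ℝ → ℝ → ℝ := fun m t => (1 + m) * Real.sqrt (1 - m * Real.sin t ^ 2)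
        - (1 - m) * (1 / Real.sqrt (1 - m * Real.sin t ^ 2))
  let r : ℝ → ℝ → ℝ := fun m t =>
    (Real.cos t ^ 2 - Real.sin t ^ 2) / (2 * Real.sqrt (1 - m * Real.sin t ^ 2))
        + m * Real.sin t ^ 2 * Real.cos t ^ 2 / (2 * Real.sqrt (1 - m * Real.sin t ^ 2) ^ 3)
  let f' : ℝ → ℝ → ℝ := fun m t => 3 / 2 * Real.sqrt (1 - m * Real.sin t ^ 2) + r m t
  have hne : ∀ p ∈ Iio (1:ℝ) ×ˢ (univ : Set ℝ), Real.sqrt (1 - p.1 * Real.sin p.2 ^ 2) ≠ 0 :=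
    fun p hp => (Real.sqrt_pos.2 (one_sub_mul_sin_sq_pos hp.1 p.2)).ne'
  have hf : ContinuousOn f.uncurry (Iio 1 ×ˢ univ) := by
    unfold Function.uncurry f
    fun_prop (disch := assumption)
  have hr : ContinuousOn r.uncurry (Iio 1 ×ˢ univ) := by
    unfold Function.uncurry r
    refine ContinuousOn.add (ContinuousOn.div (by fun_prop) (by fun_prop) fun p hp => ?_)
      (ContinuousOn.div (by fun_prop) (by fun_prop) fun p hp => ?_)
    · exact mul_ne_zero two_ne_zero (hne p hp)
    · exact mul_ne_zero two_ne_zero (pow_ne_zero 3 (hne p hp))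
  have hf' : ContinuousOn f'.uncurry (Iio 1 ×ˢ univ) := by
    refine ContinuousOn.add (f := fun p : ℝ × ℝ => 3 / 2 * Real.sqrt (1 - p.1 * Real.sin p.2 ^ 2))
      (by fun_prop) hr
  have hd : ∀ x ∈ Iio (1:ℝ), ∀ t, HasDerivAt (fun y => f y t) (f' x t) x := by
    intro x hx t
    have hp := one_sub_mul_sin_sq_pos hx t
    have hu := Real.sqrt_pos.2 hp
    have hs := hasDerivAt_sqrt_one_sub_mul hp
    have h := (((hasDerivAt_id x).const_add 1).mul hs).sub
      (((hasDerivAt_id x).const_sub 1).mul ((hasDerivAt_const x (1:ℝ)).div hs hu.ne'))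
    refine h.congr_deriv ?_
    have hsq := Real.sq_sqrt hp.le
    simp only [f', r, id, Pi.div_apply, Real.cos_sq']
    set u := Real.sqrt (1 - x * Real.sin t ^ 2)
    set y := Real.sin t ^ 2
    have h4 : u ^ 4 = (1 - x * y) ^ 2 := by rw [← hsq]; ring
    field_simp
    ring_nf
    simp only [h4, hsq]
    ring
  have hder := hasDerivAt_intervalIntegral_of_continuousOn (a := 0) (b := Real.pi / 2)
    isOpen_Iio (mem_Iio.2 hm) hf hf' hd
  have hrc : Continuous (r m) :=
    hr.comp_continuous (f := fun t => (m, t)) (by fun_prop) fun t => ⟨hm, mem_univ t⟩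
  have hr0 : ∫ t in (0:ℝ)..(Real.pi / 2), r m t = 0 := by
    rw [intervalIntegral.integral_eq_sub_of_hasDerivAt
      (fun t _ => hasDerivAt_sin_mul_cos_div hm t) (hrc.intervalIntegrable _ _)]
    simp
  have hval : ∫ t in (0:ℝ)..(Real.pi / 2), f' m t = 3 / 2 * ellEParam m := by
    simp only [f']
    rw [intervalIntegral.integral_add (Continuous.intervalIntegrable (by fun_prop) _ _)
      (hrc.intervalIntegrable _ _), hr0, intervalIntegral.integral_const_mul, add_zero, ellEParam]
  rw [hval] at hder
  exact hder.congr_of_eventuallyEq <| by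
    filter_upwards [Iio_mem_nhds hm] with x hx using ellBracket_eq_integral hx

/-- The squared modulus `κ(c)²` as a smooth function of `c < 1/4`. -/
noncomputable def kapSq (c : ℝ) : ℝ := 2 / (1 + Real.sqrt (1 - 4 * c)) - 1

lemma one_add_kapSq (c : ℝ) : 1 + kapSq c = 2 / (1 + Real.sqrt (1 - 4 * c)) := by
  simp [kapSq]

lemma one_add_kapSq_pos (c : ℝ) : 0 < 1 + kapSq c := by
  rw [one_add_kapSq]; positivity

lemma kapSq_lt_one {c : ℝ} (hc : c < 1/4) : kapSq c < 1 := by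
  have hs : 0 < Real.sqrt (1 - 4 * c) := Real.sqrt_pos.2 (by linarith)
  have : 2 / (1 + Real.sqrt (1 - 4 * c)) < 2 := by
    rw [div_lt_iff₀ (by positivity)]; linarith
  unfold kapSq; linarith

lemma continuous_kapSq : Continuous kapSq :=
  (continuous_const.div (by fun_prop) fun c => by positivity).sub continuous_const

lemma kapC_sq {c : ℝ} (hc : 0 ≤ c) : kapC c ^ 2 = kapSq c := by
  have hs : Real.sqrt (1 - 4 * c) ≤ 1 := Real.sqrt_le_one.2 (by linarith)
  have hs0 := Real.sqrt_nonneg (1 - 4 * c)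
  rw [kapC, aAmp, bAmp, div_pow, Real.sq_sqrt (by linarith), Real.sq_sqrt (by linarith), kapSq]
  field_simp
  ring

lemma hasDerivAt_kapSq {c : ℝ} (hc : c < 1/4) :
    HasDerivAt kapSq ((1 + kapSq c) ^ 3 / (1 - kapSq c)) c := by
  have hp : 0 < 1 - 4 * c := by linarith
  have hs := Real.sqrt_pos.2 hp
  have h1 := (((hasDerivAt_id c).const_mul 4).const_sub 1).sqrt hp.ne'
  have h := ((hasDerivAt_const c (2:ℝ)).div (h1.const_add 1)
    (by simp only [id]; positivity)).sub_const 1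
  refine h.congr_deriv ?_
  have hm := kapSq_lt_one hc
  have h2 : 1 - kapSq c = 2 * Real.sqrt (1 - 4 * c) / (1 + Real.sqrt (1 - 4 * c)) := by
    unfold kapSq; field_simp; ring
  rw [h2, one_add_kapSq]
  simp only [id]
  field_simp
  ring

/-- The closed form of the action integral. -/
noncomputable def actionC (c : ℝ) : ℝ :=
  4 / (3 * Real.pi) * (ellBracket (kapSq c) / (1 + kapSq c) ^ ((3:ℝ)/2))

lemma inv_OmegaC {c : ℝ} (hc : 0 ≤ c) :
    (OmegaC c)⁻¹ = 2 / Real.pi * (Real.sqrt (1 + kapSq c) * ellKParam (kapSq c)) := by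
  have hK : ellK (kapC c) = ellKParam (kapSq c) := by rw [← kapC_sq hc]; rfl
  have hb : bAmp c * Real.sqrt (1 + kapSq c) = Real.sqrt 2 := by
    rw [one_add_kapSq, bAmp, ← Real.sqrt_mul (by positivity)]
    congr 1
    field_simp
  have hb0 : 0 < bAmp c := Real.sqrt_pos.2 (by positivity)
  have hq := Real.sqrt_pos.2 (one_add_kapSq_pos c)
  rw [OmegaC, hK, ← hb]
  field_simp

lemma hasDerivAt_actionC {c : ℝ} (hc : c < 1/4) :
    HasDerivAt actionC (2 / Real.pi * (Real.sqrt (1 + kapSq c) * ellKParam (kapSq c))) c := by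
  have hm := kapSq_lt_one hc
  have hp := one_add_kapSq_pos c
  have hk := hasDerivAt_kapSq hc
  have h1 := (hasDerivAt_ellBracket hm).comp c hk
  have h2 := (hk.const_add 1).rpow_const (p := (3:ℝ)/2) (Or.inl hp.ne')
  have h := (h1.div h2 (Real.rpow_pos_of_pos hp _).ne').const_mul (4 / (3 * Real.pi))
  refine h.congr_deriv ?_
  have e1 : (1 + kapSq c) ^ ((3:ℝ)/2 - 1) = Real.sqrt (1 + kapSq c) := by
    rw [Real.sqrt_eq_rpow]; norm_num
  have e2 : (1 + kapSq c) ^ ((3:ℝ)/2) = (1 + kapSq c) * Real.sqrt (1 + kapSq c) := by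
    rw [Real.sqrt_eq_rpow, ← Real.rpow_one_add' hp.le (by norm_num)]; norm_num
  rw [e1, e2]
  have hq := Real.sqrt_pos.2 hp
  have hsq := Real.sq_sqrt hp.le
  have hm' : 0 < 1 - kapSq c := by linarith
  simp only [Function.comp, ellBracket]
  set q := Real.sqrt (1 + kapSq c)
  set m := kapSq c
  have hmq : m = q ^ 2 - 1 := by linarith
  have hpi := Real.pi_ne_zero
  clear_value q m
  field_simp
  rw [hsq]
  ring

lemma actionC_zero : actionC 0 = 0 := by
  simp [actionC, show kapSq 0 = 0 by norm_num [kapSq], ellBracket_zero]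

lemma strictMonoOn_actionC : StrictMonoOn actionC (Iio (1/4)) := by
  refine strictMonoOn_of_deriv_pos (convex_Iio _)
    (fun c hc => (hasDerivAt_actionC hc).continuousAt.continuousWithinAt) fun c hc => ?_
  rw [interior_Iio] at hc
  rw [(hasDerivAt_actionC hc).deriv]
  have h1 := Real.sqrt_pos.2 (one_add_kapSq_pos c)
  have h2 := ellKParam_pos (kapSq_lt_one hc)
  positivity

lemma actionC_le {c : ℝ} (hc : c < 1/4) :
    actionC c ≤ 4 / (3 * Real.pi) *
      ((1 + kapSq c) * ellEParam (kapSq c) / (1 + kapSq c) ^ ((3:ℝ)/2)) := by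
  have hm := kapSq_lt_one hc
  have hp := one_add_kapSq_pos c
  have hK := mul_pos (sub_pos.2 hm) (ellKParam_pos hm)
  unfold actionC ellBracket
  gcongr
  linarith

lemma actionC_lt {c : ℝ} (hc : c < 1/4) : actionC c < 2 * Real.sqrt 2 / (3 * Real.pi) := by
  have hk1 : kapSq (1/4) = 1 := by norm_num [kapSq]
  obtain ⟨d, hcd, hd⟩ := exists_between hc
  refine (strictMonoOn_actionC hc hd hcd).trans_le ?_
  have hcont : Continuous fun c => 4 / (3 * Real.pi) *
      ((1 + kapSq c) * ellEParam (kapSq c) / (1 + kapSq c) ^ ((3:ℝ)/2)) := by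
    have := continuous_ellEParam.comp continuous_kapSq
    refine continuous_const.mul (Continuous.div ?_ ?_ ?_)
    · exact (continuous_const.add continuous_kapSq).mul this
    · exact (continuous_const.add continuous_kapSq).rpow_const fun c => Or.inr (by norm_num)
    · exact fun c => (Real.rpow_pos_of_pos (one_add_kapSq_pos c) _).ne'
  have hval : 4 / (3 * Real.pi) * ((1 + kapSq (1/4)) * ellEParam (kapSq (1/4))
      / (1 + kapSq (1/4)) ^ ((3:ℝ)/2)) = 2 * Real.sqrt 2 / (3 * Real.pi) := by
    have e : (2:ℝ) ^ ((3:ℝ)/2) = 2 * Real.sqrt 2 := by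
      rw [Real.sqrt_eq_rpow, ← Real.rpow_one_add' (by norm_num) (by norm_num)]; norm_num
    have h2 : Real.sqrt 2 ^ 2 = 2 := Real.sq_sqrt (by norm_num)
    rw [hk1, ellEParam_one, one_add_one_eq_two, e]
    have := Real.pi_ne_zero
    field_simp
    linarith
  rw [← hval]
  refine ge_of_tendsto (hcont.continuousWithinAt (s := Iio (1/4)) (x := 1/4)) ?_
  filter_upwards [Ioo_mem_nhdsLT hd] with e he
  exact (strictMonoOn_actionC hd he.2 he.1).le.trans (actionC_le he.2)

lemma integral_inv_OmegaC {c : ℝ} (hc0 : 0 ≤ c) (hc1 : c < 1/4) :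
    ∫ c' in (0:ℝ)..c, (OmegaC c')⁻¹ = actionC c := by
  have hlt {x : ℝ} (hx : x ∈ uIcc 0 c) : x < 1/4 := by
    rw [uIcc_of_le hc0] at hx; exact hx.2.trans_lt hc1
  have hcongr : EqOn (fun c' => (OmegaC c')⁻¹)
      (fun c' => 2 / Real.pi * (Real.sqrt (1 + kapSq c') * ellKParam (kapSq c'))) (uIcc 0 c) :=
    fun x hx => inv_OmegaC (by rw [uIcc_of_le hc0] at hx; exact hx.1)
  rw [intervalIntegral.integral_congr hcongr, intervalIntegral.integral_eq_sub_of_hasDerivAt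
    (fun x hx => hasDerivAt_actionC (hlt hx)), actionC_zero, sub_zero]
  refine ContinuousOn.intervalIntegrable fun x hx => ContinuousAt.continuousWithinAt ?_
  have hm := kapSq_lt_one (hlt hx)
  have hK : ContinuousAt ellKParam (kapSq x) := by
    have h : ContinuousAt (fun m => ((1 + m) * ellEParam m - ellBracket m) / (1 - m)) (kapSq x) :=
      ((by fun_prop : ContinuousAt (fun m : ℝ => 1 + m) _).mul
        continuous_ellEParam.continuousAt |>.sub (hasDerivAt_ellBracket hm).continuousAt).div
        (by fun_prop) (by linarith)
    refine h.congr ?_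
    filter_upwards [Iio_mem_nhds hm] with m hm'
    rw [ellBracket, sub_sub_cancel, mul_div_cancel_left₀ _ (by linarith [mem_Iio.1 hm'])]
  have hk := continuous_kapSq.continuousAt (x := x)
  exact continuousAt_const.mul
    ((continuousAt_const.add hk).sqrt.mul (ContinuousAt.comp (f := kapSq) hK hk))

/-- for `0 < c < 1/4`, the action integral satisfies
`∫₀ᶜ Ω(c′)⁻¹ dc′ = (4/(3π))·[(1+κ²)E(κ) − (1−κ²)K(κ)]/(1+κ²)^{3/2}` with `κ = κ(c)`,
and this quantity lies in `[0, 2√2/(3π))`. -/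
theorem statement12 (c : ℝ) (hc0 : 0 < c) (hc1 : c < 1/4) :
    (∫ c' in (0:ℝ)..c, (OmegaC c')⁻¹)
        = 4 / (3 * Real.pi) *
          (((1 + kapC c^2) * ellE (kapC c) - (1 - kapC c^2) * ellK (kapC c))
            / (1 + kapC c^2) ^ ((3:ℝ)/2)) ∧
    (∫ c' in (0:ℝ)..c, (OmegaC c')⁻¹) ∈
      Set.Ico (0:ℝ) (2 * Real.sqrt 2 / (3 * Real.pi)) := by
  rw [integral_inv_OmegaC hc0.le hc1]
  refine ⟨?_, ?_, actionC_lt hc1⟩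
  · rw [kapC_sq hc0.le,
      show ellE (kapC c) = ellEParam (kapSq c) by rw [← kapC_sq hc0.le]; rfl,
      show ellK (kapC c) = ellKParam (kapSq c) by rw [← kapC_sq hc0.le]; rfl]
    rfl
  · rw [← actionC_zero]
    exact (strictMonoOn_actionC (by norm_num) hc1 hc0).le
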